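/- There exist absolute constants c (with c = e^{c₂ - c₁ + 2} for suitable Mertens constants c₁, c₂) such that for all sufficiently large b₁, the density 1 - ∏_{b₁ ≤ p ≤ c·b₁, p prime} (1 - 1/p) is greater than 1/ln b₁. -/

import Mathlib

open Filter
open scoped Topology

/-- The weight `-log (1 - 1 / p)` at primes, and zero elsewhere. -/
noncomputable def eulerLogWeight (n : ℕ) : ℝ :=
  if n.Prime then -Real.log (1 - 1 / (n : ℝ)) else 0

lemma inv_le_neg_log_one_sub_inv {x : ℝ} (hx : 2 ≤ x) : 1 / x ≤ -Real.log (1 - 1 / x) := by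
  have h1 : 1 / x ≤ 1 / 2 := one_div_le_one_div_of_le (by norm_num) hx
  have := Real.log_le_sub_one_of_pos (x := 1 - 1 / x) (by linarith)
  linarith

lemma neg_log_one_sub_inv_le {x : ℝ} (hx : 2 ≤ x) :
    -Real.log (1 - 1 / x) ≤ 1 / (x - 1) := by
  have h1 : 1 / x ≤ 1 / 2 := one_div_le_one_div_of_le (by norm_num) hx
  have := Real.one_sub_inv_le_log_of_pos (x := 1 - 1 / x) (by linarith)
  have h2 : (1 - 1 / x)⁻¹ = 1 + 1 / (x - 1) := by
    have : x ≠ 0 := by linarith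
    have : x - 1 ≠ 0 := by linarith
    field_simp
    ring
  linarith

lemma inv_sub_one_le {x : ℝ} (hx : 2 ≤ x) : 1 / (x - 1) ≤ 1 / x + 2 / x ^ 2 := by
  have h3 : 0 < x - 1 := by linarith
  rw [div_add_div _ _ (by positivity) (by positivity), div_le_div_iff₀ h3 (by positivity)]
  nlinarith [mul_nonneg (show (0 : ℝ) ≤ x by linarith) (show (0 : ℝ) ≤ x - 2 by linarith)]

lemma eulerLogWeight_nonneg (n : ℕ) : 0 ≤ eulerLogWeight n := by
  unfold eulerLogWeight
  split_ifs with h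
  · have h2 : (2 : ℝ) ≤ n := by exact_mod_cast h.two_le
    exact le_trans (by positivity) (inv_le_neg_log_one_sub_inv h2)
  · exact le_rfl

lemma summable_log_div_sq : Summable (fun n : ℕ => Real.log n / (n : ℝ) ^ 2) := by
  have h := (Real.summable_nat_rpow_inv.mpr (show (1 : ℝ) < 3 / 2 by norm_num)).mul_left 2
  refine Summable.of_nonneg_of_le (fun n => div_nonneg (Real.log_natCast_nonneg n) (by positivity))
    (fun n => ?_) h
  rcases Nat.eq_zero_or_pos n with rfl | hn
  · simp
  have hn' : (0 : ℝ) < n := by exact_mod_cast hn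
  have hl := Real.log_le_rpow_div hn'.le (show (0 : ℝ) < 1 / 2 by norm_num)
  have e : (n : ℝ) ^ 2 = (n : ℝ) ^ (1 / 2 : ℝ) * (n : ℝ) ^ (3 / 2 : ℝ) := by
    rw [← Real.rpow_add hn', ← Real.rpow_natCast]
    norm_num
  rw [div_le_iff₀ (by positivity), e]
  have : (n : ℝ) ^ (3 / 2 : ℝ) ≠ 0 := by positivity
  field_simp
  linarith

lemma log_factorial_eq_sum_padicValNat (n : ℕ) :
    Real.log (n.factorial) =
      ∑ p ∈ (Finset.range (n + 1)).filter Nat.Prime,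
        (padicValNat p n.factorial : ℝ) * Real.log p := by
  have h : ∏ p ∈ (Finset.range (n + 1)).filter Nat.Prime, p ^ padicValNat p n.factorial =
      n.factorial := by
    conv_rhs => rw [← Nat.prod_factorization_pow_eq_self n.factorial_ne_zero]
    rw [Finsupp.prod, Nat.support_factorization]
    symm
    refine Finset.prod_subset_one_on_sdiff ?_ ?_ ?_
    · intro p hp
      have hp' := Nat.mem_primeFactors.mp hp
      have := (hp'.1.dvd_factorial).mp hp'.2.1
      simp only [Finset.mem_filter, Finset.mem_range]
      exact ⟨by omega, hp'.1⟩
    · intro p hp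
      simp only [Finset.mem_sdiff, Finset.mem_filter] at hp
      have : ¬ p ∣ n.factorial := fun hd =>
        hp.2 (Nat.mem_primeFactors.mpr ⟨hp.1.2, hd, n.factorial_ne_zero⟩)
      rw [padicValNat.eq_zero_of_not_dvd this, pow_zero]
    · intro p hp
      rw [Nat.factorization_def _ (Nat.prime_of_mem_primeFactors hp)]
  conv_lhs => rw [← h]
  push_cast
  rw [Real.log_prod]
  · simp_rw [Real.log_pow]
  · intro p hp
    have : (p : ℝ) ≠ 0 := by exact_mod_cast (Finset.mem_filter.mp hp).2.ne_zero
    positivity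

lemma div_sub_one_le_padicValNat_factorial {p : ℕ} (hp : p.Prime) (n : ℕ) :
    (n : ℝ) / p - 1 ≤ padicValNat p n.factorial := by
  have h1 : n / p ≤ padicValNat p n.factorial := by
    have := Fact.mk hp
    rw [← padicValNat_dvd_iff_le n.factorial_ne_zero]
    have h : (p ^ (n / p)) ∣ (p * (n / p)).factorial := by
      rw [padicValNat_dvd_iff_le (Nat.factorial_ne_zero _), padicValNat_factorial_mul]
      omega
    exact h.trans (Nat.factorial_dvd_factorial (Nat.mul_div_le n p))
  have h2 := Nat.lt_floor_add_one ((n : ℝ) / p)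
  rw [Nat.floor_div_natCast, Nat.floor_natCast] at h2
  have h3 : ((n / p : ℕ) : ℝ) ≤ padicValNat p n.factorial := by exact_mod_cast h1
  linarith

lemma padicValNat_factorial_le_div {p : ℕ} (hp : p.Prime) (n : ℕ) :
    (padicValNat p n.factorial : ℝ) ≤ n / ((p : ℝ) - 1) := by
  have := Fact.mk hp
  have h1 := sub_one_mul_padicValNat_factorial (p := p) n
  have h2 : (p - 1) * padicValNat p n.factorial ≤ n := by omega
  have h3 : (((p - 1 : ℕ) : ℝ)) * padicValNat p n.factorial ≤ n := by exact_mod_cast h2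
  rw [Nat.cast_sub hp.one_le, Nat.cast_one] at h3
  have : (1 : ℝ) < p := by exact_mod_cast hp.one_lt
  rw [le_div_iff₀ (by linarith)]
  linarith

/-- A form of Mertens' first theorem. -/
lemma exists_abs_sum_eulerLogWeight_mul_log_sub_log_le :
    ∃ R : ℝ, 0 ≤ R ∧ ∀ n : ℕ, 1 ≤ n →
      |∑ k ∈ Finset.range n, eulerLogWeight k * Real.log k - Real.log n| ≤ R := by
  set S := ∑' n : ℕ, Real.log n / (n : ℝ) ^ 2 with hS
  have hS0 : 0 ≤ S :=
    tsum_nonneg fun n => div_nonneg (Real.log_natCast_nonneg n) (by positivity)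
  have key : ∀ n : ℕ, 1 ≤ n →
      |∑ k ∈ Finset.range (n + 1), eulerLogWeight k * Real.log k - Real.log n| ≤
        2 * S + Real.log 4 + 1 := by
    intro n hn
    have hn' : (0 : ℝ) < n := by exact_mod_cast hn
    set P := (Finset.range (n + 1)).filter Nat.Prime
    have e1 : ∑ k ∈ Finset.range (n + 1), eulerLogWeight k * Real.log k =
        ∑ p ∈ P, -Real.log (1 - 1 / (p : ℝ)) * Real.log p := by
      rw [Finset.sum_filter]
      refine Finset.sum_congr rfl fun k _ => ?_
      unfold eulerLogWeight
      split_ifs <;> simp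
    have hSP : ∑ p ∈ P, Real.log p / (p : ℝ) ^ 2 ≤ S :=
      summable_log_div_sq.sum_le_tsum _
        fun n _ => div_nonneg (Real.log_natCast_nonneg n) (by positivity)
    have hθ : ∑ p ∈ P, Real.log p ≤ Real.log 4 * n := by
      have h := Chebyshev.theta_le_log4_mul_x hn'.le
      rw [Chebyshev.theta_eq_sum_primesLE_log] at h
      refine le_trans (le_of_eq (Finset.sum_congr ?_ fun _ _ => rfl)) h
      ext p
      simp [P, Nat.mem_primesLE]
    have hfac := log_factorial_eq_sum_padicValNat n
    have hbase : ∀ p ∈ P, (2 : ℝ) ≤ p := fun p hp => by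
      exact_mod_cast (Finset.mem_filter.mp hp).2.two_le
    have hup : ∑ p ∈ P, -Real.log (1 - 1 / (p : ℝ)) * Real.log p * n ≤
        ∑ p ∈ P, ((padicValNat p n.factorial : ℝ) * Real.log p + Real.log p +
          2 * n * (Real.log p / (p : ℝ) ^ 2)) := by
      refine Finset.sum_le_sum fun p hp => ?_
      have h1 := neg_log_one_sub_inv_le (hbase p hp)
      have h2 := div_sub_one_le_padicValNat_factorial (Finset.mem_filter.mp hp).2 n
      have h3 := inv_sub_one_le (hbase p hp)
      have h4 : -Real.log (1 - 1 / (p : ℝ)) * n ≤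
          padicValNat p n.factorial + 1 + 2 * n / (p : ℝ) ^ 2 := by
        have h5 := mul_le_mul_of_nonneg_right (h1.trans h3) hn'.le
        have h6 : (1 / (p : ℝ) + 2 / (p : ℝ) ^ 2) * n = n / p + 2 * n / (p : ℝ) ^ 2 := by ring
        linarith
      have h7 := mul_le_mul_of_nonneg_right h4 (Real.log_natCast_nonneg p)
      calc _ = _ := by ring
        _ ≤ _ := h7
        _ = _ := by ring
    have hlow : ∑ p ∈ P, (padicValNat p n.factorial : ℝ) * Real.log p ≤
        ∑ p ∈ P, (-Real.log (1 - 1 / (p : ℝ)) * Real.log p * n +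
          2 * n * (Real.log p / (p : ℝ) ^ 2)) := by
      refine Finset.sum_le_sum fun p hp => ?_
      have h1 := inv_le_neg_log_one_sub_inv (hbase p hp)
      have h2 := padicValNat_factorial_le_div (Finset.mem_filter.mp hp).2 n
      have h3 := inv_sub_one_le (hbase p hp)
      have h4 : (padicValNat p n.factorial : ℝ) ≤
          -Real.log (1 - 1 / (p : ℝ)) * n + 2 * n / (p : ℝ) ^ 2 := by
        have h5 := mul_le_mul_of_nonneg_right (h3.trans (add_le_add_left h1 _)) hn'.le
        calc _ ≤ _ := h2
          _ = 1 / ((p : ℝ) - 1) * n := by ring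
          _ ≤ _ := h5
          _ = _ := by ring
      have h7 := mul_le_mul_of_nonneg_right h4 (Real.log_natCast_nonneg p)
      calc _ ≤ _ := h7
        _ = _ := by ring
    rw [Finset.sum_add_distrib, ← Finset.sum_mul, ← Finset.mul_sum] at hlow
    rw [Finset.sum_add_distrib, Finset.sum_add_distrib, ← Finset.sum_mul, ← Finset.mul_sum] at hup
    rw [← hfac] at hlow hup
    have hf1 : Real.log n.factorial ≤ n * Real.log n := by
      rw [← Real.log_pow]
      exact Real.log_le_log (by exact_mod_cast n.factorial_pos)
        (by exact_mod_cast n.factorial_le_pow)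
    have hf2 : n * Real.log n - n ≤ Real.log n.factorial := by
      have h := Stirling.le_log_factorial_stirling (n := n) (by omega)
      have hlog := Real.log_natCast_nonneg n
      have hpi : 0 ≤ Real.log (2 * Real.pi) := Real.log_nonneg (by linarith [Real.pi_gt_three])
      linarith
    have hSn := mul_le_mul_of_nonneg_left hSP (show (0 : ℝ) ≤ 2 * n by positivity)
    rw [e1]
    set G := ∑ p ∈ P, -Real.log (1 - 1 / (p : ℝ)) * Real.log p
    have hl4 : 0 ≤ Real.log 4 := Real.log_nonneg (by norm_num)
    rw [abs_le]
    constructor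
    · refine le_of_mul_le_mul_right ?_ hn'
      nlinarith
    · refine le_of_mul_le_mul_right ?_ hn'
      nlinarith
  refine ⟨2 * S + Real.log 4 + 1 + Real.log 2, ?_, ?_⟩
  · have := Real.log_nonneg (show (1 : ℝ) ≤ 4 by norm_num)
    have := Real.log_nonneg (show (1 : ℝ) ≤ 2 by norm_num)
    linarith
  intro n hn
  have hl4 := Real.log_nonneg (show (1 : ℝ) ≤ 4 by norm_num)
  obtain ⟨m, rfl⟩ : ∃ m, n = m + 1 := ⟨n - 1, by omega⟩
  rcases Nat.eq_zero_or_pos m with rfl | hm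
  · have := Real.log_nonneg (show (1 : ℝ) ≤ 2 by norm_num)
    simp
    linarith
  have h := key m hm
  have hm' : (1 : ℝ) ≤ m := by exact_mod_cast hm
  have h1 : Real.log m ≤ Real.log ((m + 1 : ℕ) : ℝ) :=
    Real.log_le_log (by linarith) (by push_cast; linarith)
  have h2 : Real.log ((m + 1 : ℕ) : ℝ) ≤ Real.log 2 + Real.log m := by
    rw [← Real.log_mul (by norm_num) (by linarith)]
    exact Real.log_le_log (by positivity) (by push_cast; linarith)
  rw [abs_le] at h ⊢
  constructor <;> linarith

lemma exists_abs_sub_le_of_abs_succ_sub_le {W u : ℕ → ℝ} {N : ℕ}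
    (hu : Tendsto u atTop (𝓝 0)) (hW : ∀ k ≥ N, |W (k + 1) - W k| ≤ u k - u (k + 1)) :
    ∃ C, ∀ m ≥ N, |W m - C| ≤ u m := by
  have hmn : ∀ m ≥ N, ∀ n ≥ m, |W n - W m| ≤ u m - u n := by
    intro m hm n hn
    induction n, hn using Nat.le_induction with
    | base => simp
    | succ n hn ih =>
      have h1 := hW n (hm.trans hn)
      have h2 := abs_sub_le (W (n + 1)) (W n) (W m)
      linarith
  have hpos : ∀ m ≥ N, 0 ≤ u m := by
    intro m hm
    refine le_of_tendsto hu ?_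
    filter_upwards [eventually_ge_atTop m] with n hn
    linarith [hmn m hm n hn, abs_nonneg (W n - W m)]
  have hcau : CauchySeq fun n => W (n + N) := by
    refine cauchySeq_of_le_tendsto_0 (fun n => 2 * u (n + N)) ?_ ?_
    · intro n m M hn hm
      rw [Real.dist_eq]
      have h1 := hmn (M + N) (by omega) (n + N) (by omega)
      have h2 := hmn (M + N) (by omega) (m + N) (by omega)
      have h3 := abs_sub_le (W (n + N)) (W (M + N)) (W (m + N))
      rw [abs_sub_comm (W (M + N))] at h3
      linarith [hpos (n + N) (by omega), hpos (m + N) (by omega)]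
    · simpa using ((tendsto_add_atTop_iff_nat N).mpr hu).const_mul 2
  obtain ⟨C, hC⟩ := cauchySeq_tendsto_of_complete hcau
  rw [tendsto_add_atTop_iff_nat N (f := W)] at hC
  refine ⟨C, fun m hm => ?_⟩
  rw [abs_sub_comm]
  refine le_of_tendsto ((hC.sub_const (W m)).abs) ?_
  filter_upwards [eventually_ge_atTop m] with n hn
  linarith [hmn m hm n hn, hpos n (hm.trans hn)]

/-- Mertens' second theorem with an unspecified constant. -/
lemma exists_abs_sum_eulerLogWeight_sub_log_log_sub_le :
    ∃ C K : ℝ, 0 ≤ K ∧ ∀ n : ℕ, 2 ≤ n →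
      |∑ k ∈ Finset.range n, eulerLogWeight k - Real.log (Real.log n) - C| ≤ K / Real.log n := by
  obtain ⟨R, hR0, hR⟩ := exists_abs_sum_eulerLogWeight_mul_log_sub_log_le
  set A : ℕ → ℝ := fun n => ∑ k ∈ Finset.range n, eulerLogWeight k with hA
  set r : ℕ → ℝ := fun n =>
    ∑ k ∈ Finset.range n, eulerLogWeight k * Real.log k - Real.log n with hr
  set W : ℕ → ℝ := fun n => A n - Real.log (Real.log n) - r n / Real.log n with hW
  have hu : Tendsto (fun n : ℕ => (1 + R) / Real.log n) atTop (𝓝 0) :=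
    (Real.tendsto_log_atTop.comp tendsto_natCast_atTop_atTop).const_div_atTop _
  obtain ⟨C, hC⟩ := exists_abs_sub_le_of_abs_succ_sub_le (W := W) (N := 2) hu (by
    intro k hk
    have hk' : (2 : ℝ) ≤ k := by exact_mod_cast hk
    have hl : 0 < Real.log k := Real.log_pos (by linarith)
    set a := Real.log k with ha
    set b := Real.log ((k + 1 : ℕ) : ℝ) with hb
    have hab : a ≤ b := Real.log_le_log (by linarith) (by push_cast; linarith)
    have hb0 : 0 < b := hl.trans_le hab
    have hba : b - a ≤ 1 := by
      have h1 : b ≤ Real.log (2 * k) :=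
        Real.log_le_log (by positivity) (by push_cast; linarith)
      rw [Real.log_mul (by norm_num) (by linarith)] at h1
      linarith [Real.log_two_lt_d9]
    have hr1 : |r (k + 1)| ≤ R := hR (k + 1) (by omega)
    have hAk : A (k + 1) = A k + eulerLogWeight k := Finset.sum_range_succ _ _
    have hrk : r (k + 1) = r k + eulerLogWeight k * a - (b - a) := by
      simp only [hr, Finset.sum_range_succ]
      ring
    have hll1 : Real.log b - Real.log a ≤ (b - a) / a := by
      rw [← Real.log_div hb0.ne' hl.ne']
      refine (Real.log_le_sub_one_of_pos (by positivity)).trans (le_of_eq ?_)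
      field_simp
    have hll2 : (b - a) / b ≤ Real.log b - Real.log a := by
      rw [← Real.log_div hb0.ne' hl.ne']
      refine le_trans (le_of_eq ?_) (Real.one_sub_inv_le_log_of_pos (by positivity))
      field_simp
    have hinv : 0 ≤ 1 / a - 1 / b := by
      have := one_div_le_one_div_of_le hl hab
      linarith
    have e : W (k + 1) - W k =
        ((b - a) / a - (Real.log b - Real.log a)) + r (k + 1) * (1 / a - 1 / b) := by
      have e1 : W (k + 1) = A k + eulerLogWeight k - Real.log b - r (k + 1) / b := by
        rw [← hAk]
      have e2 : W k = A k - Real.log a - r k / a := rfl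
      have e3 : r k = r (k + 1) - eulerLogWeight k * a + (b - a) := by linarith
      rw [e1, e2, e3]
      field_simp
      ring
    have h1 : |(b - a) / a - (Real.log b - Real.log a)| ≤ 1 / a - 1 / b := by
      rw [abs_of_nonneg (by linarith)]
      have h2 : (b - a) / a - (b - a) / b = (b - a) * (1 / a - 1 / b) := by ring
      have h3 := mul_le_mul_of_nonneg_right hba hinv
      linarith
    have h2 : |r (k + 1) * (1 / a - 1 / b)| ≤ R * (1 / a - 1 / b) := by
      rw [abs_mul, abs_of_nonneg hinv]
      exact mul_le_mul_of_nonneg_right hr1 hinv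
    rw [e]
    refine (abs_add_le _ _).trans ((add_le_add h1 h2).trans (le_of_eq ?_))
    ring)
  refine ⟨C, 1 + 2 * R, by linarith, fun n hn => ?_⟩
  have hn' : (2 : ℝ) ≤ n := by exact_mod_cast hn
  have hl : 0 < Real.log n := Real.log_pos (by linarith)
  have h1 := hC n hn
  have h2 : |r n / Real.log n| ≤ R / Real.log n := by
    rw [abs_div, abs_of_pos hl]
    exact div_le_div_of_nonneg_right (hR n (by omega)) hl.le
  have e : A n - Real.log (Real.log n) - C = (W n - C) + r n / Real.log n := by
    simp only [hW]
    ring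
  change |A n - Real.log (Real.log n) - C| ≤ _
  rw [e]
  refine (abs_add_le _ _).trans ((add_le_add h1 h2).trans (le_of_eq ?_))
  ring

/-- The logarithm of the Euler factor of `ζ (1 + δ)` at primes, and zero elsewhere. -/
noncomputable def zetaLogWeight (δ : ℝ) (n : ℕ) : ℝ :=
  if n.Prime then -Real.log (1 - 1 / (n : ℝ) ^ (1 + δ)) else 0

lemma abs_eulerLogWeight_mul_sub_zetaLogWeight_le {δ : ℝ} (hδ : 0 ≤ δ) (n : ℕ) :
    |eulerLogWeight n * (n : ℝ) ^ (-δ) - zetaLogWeight δ n| ≤ 2 / (n : ℝ) ^ 2 := by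
  unfold eulerLogWeight zetaLogWeight
  split_ifs with h
  · have h2 : (2 : ℝ) ≤ n := by exact_mod_cast h.two_le
    have hn0 : (0 : ℝ) < n := by linarith
    set z := (n : ℝ) ^ (-δ) with hz
    have hz0 : 0 < z := by positivity
    have hz1 : z ≤ 1 := Real.rpow_le_one_of_one_le_of_nonpos (by linarith) (by linarith)
    have hx2 : (2 : ℝ) ≤ (n : ℝ) ^ (1 + δ) := by
      refine h2.trans ?_
      conv_lhs => rw [← Real.rpow_one (n : ℝ)]
      exact Real.rpow_le_rpow_of_exponent_le (by linarith) (by linarith)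
    have hxz : 1 / (n : ℝ) ^ (1 + δ) = 1 / n * z := by
      rw [Real.rpow_add hn0, Real.rpow_one, hz, Real.rpow_neg hn0.le]
      field_simp
    have a1 := inv_le_neg_log_one_sub_inv h2
    have a2 := (neg_log_one_sub_inv_le h2).trans (inv_sub_one_le h2)
    have b1 := inv_le_neg_log_one_sub_inv hx2
    have b2 := (neg_log_one_sub_inv_le hx2).trans (inv_sub_one_le hx2)
    have e : 2 / ((n : ℝ) ^ (1 + δ)) ^ 2 = 2 / (n : ℝ) ^ 2 * z ^ 2 := by
      have : 2 / ((n : ℝ) ^ (1 + δ)) ^ 2 = 2 * (1 / (n : ℝ) ^ (1 + δ)) ^ 2 := by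
        field_simp
      rw [this, hxz]
      field_simp
    rw [e, hxz] at b2
    rw [hxz] at b1 ⊢
    have c1 := mul_le_mul_of_nonneg_right a1 hz0.le
    have c2 := mul_le_mul_of_nonneg_right a2 hz0.le
    have hq : 0 < 2 / (n : ℝ) ^ 2 := by positivity
    have d1 : 2 / (n : ℝ) ^ 2 * z ≤ 2 / (n : ℝ) ^ 2 := mul_le_of_le_one_right hq.le hz1
    have d2 : 2 / (n : ℝ) ^ 2 * z ^ 2 ≤ 2 / (n : ℝ) ^ 2 :=
      mul_le_of_le_one_right hq.le (pow_le_one₀ hz0.le hz1)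
    rw [abs_le]
    constructor <;> linarith
  · simp
    positivity

lemma eulerLogWeight_le (n : ℕ) : eulerLogWeight n ≤ 2 * (n : ℝ)⁻¹ := by
  unfold eulerLogWeight
  split_ifs with h
  · have h2 : (2 : ℝ) ≤ n := by exact_mod_cast h.two_le
    refine (neg_log_one_sub_inv_le h2).trans ?_
    rw [← div_eq_mul_inv, div_le_div_iff₀ (by linarith) (by linarith)]
    linarith
  · positivity

lemma summable_eulerLogWeight_mul_rpow {δ : ℝ} (hδ : 0 < δ) :
    Summable fun n : ℕ => eulerLogWeight n * (n : ℝ) ^ (-δ) := by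
  have h := (Real.summable_nat_rpow_inv.mpr (show (1 : ℝ) < 1 + δ by linarith)).mul_left 2
  refine Summable.of_nonneg_of_le
    (fun n => mul_nonneg (eulerLogWeight_nonneg n) (by positivity)) (fun n => ?_) h
  rcases Nat.eq_zero_or_pos n with rfl | hn
  · simp [eulerLogWeight]
    positivity
  have hn0 : (0 : ℝ) < n := by exact_mod_cast hn
  refine (mul_le_mul_of_nonneg_right (eulerLogWeight_le n) (by positivity)).trans (le_of_eq ?_)
  rw [Real.rpow_add hn0, Real.rpow_one, Real.rpow_neg hn0.le]
  field_simp

lemma summable_two_div_sq : Summable fun n : ℕ => 2 / (n : ℝ) ^ 2 := by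
  simpa [div_eq_mul_inv] using (Real.summable_nat_pow_inv.mpr one_lt_two).mul_left 2

lemma summable_eulerLogWeight_mul_sub_zetaLogWeight {δ : ℝ} (hδ : 0 < δ) :
    Summable fun n : ℕ => eulerLogWeight n * (n : ℝ) ^ (-δ) - zetaLogWeight δ n :=
  Summable.of_norm_bounded summable_two_div_sq
    fun n => abs_eulerLogWeight_mul_sub_zetaLogWeight_le hδ.le n

lemma summable_zetaLogWeight {δ : ℝ} (hδ : 0 < δ) : Summable (zetaLogWeight δ) := by
  simpa using (summable_eulerLogWeight_mul_rpow hδ).sub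
    (summable_eulerLogWeight_mul_sub_zetaLogWeight hδ)

lemma tsum_zetaLogWeight {δ : ℝ} (hδ : 0 < δ) :
    ∑' n, zetaLogWeight δ n = Real.log ‖riemannZeta (1 + δ : ℝ)‖ := by
  have hs : 1 < (((1 + δ : ℝ) : ℂ)).re := by simpa using hδ
  have h0 : riemannZeta (1 + δ : ℝ) ≠ 0 := riemannZeta_ne_zero_of_one_lt_re hs
  have h1 := ((riemannZeta_eulerProduct hs).norm).log (norm_ne_zero_iff.mpr h0)
  refine tendsto_nhds_unique (summable_zetaLogWeight hδ).hasSum.tendsto_sum_nat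
    (h1.congr fun n => ?_)
  have hpos : ∀ p ∈ Nat.primesBelow n, 0 < 1 - 1 / (p : ℝ) ^ (1 + δ) := by
    intro p hp
    have h2 : (1 : ℝ) < p := by exact_mod_cast (Nat.prime_of_mem_primesBelow hp).one_lt
    have h3 : 1 < (p : ℝ) ^ (1 + δ) := Real.one_lt_rpow h2 (by linarith)
    have h4 := (div_lt_one (by linarith)).mpr h3
    linarith
  have hfac : ∀ p ∈ Nat.primesBelow n,
      ‖(1 - (p : ℂ) ^ (-((1 + δ : ℝ) : ℂ)))⁻¹‖ = (1 - 1 / (p : ℝ) ^ (1 + δ))⁻¹ := by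
    intro p hp
    have e : (1 - (p : ℂ) ^ (-((1 + δ : ℝ) : ℂ))) = ((1 - 1 / (p : ℝ) ^ (1 + δ) : ℝ) : ℂ) := by
      rw [one_div, ← Real.rpow_neg (Nat.cast_nonneg p), Complex.ofReal_sub,
        Complex.ofReal_cpow (Nat.cast_nonneg p)]
      simp
    rw [norm_inv, e, Complex.norm_real, Real.norm_of_nonneg (hpos p hp).le]
  rw [norm_prod, Finset.prod_congr rfl hfac,
    Real.log_prod fun p hp => (inv_pos.mpr (hpos p hp)).ne', Nat.primesBelow, Finset.sum_filter]
  refine Finset.sum_congr rfl fun k _ => ?_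
  unfold zetaLogWeight
  split_ifs <;> simp [Real.log_inv]

lemma tendsto_tsum_zetaLogWeight_add_log :
    Tendsto (fun δ : ℝ => ∑' n, zetaLogWeight δ n + Real.log δ) (𝓝[>] 0) (𝓝 0) := by
  have h1 : Tendsto (fun δ : ℝ => ((1 + δ : ℝ) : ℂ)) (𝓝[>] 0) (𝓝[≠] 1) := by
    refine tendsto_nhdsWithin_of_tendsto_nhds_of_eventually_within _ ?_ ?_
    · have : Continuous fun δ : ℝ => ((1 + δ : ℝ) : ℂ) := by fun_prop
      simpa using (this.tendsto 0).mono_left nhdsWithin_le_nhds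
    · filter_upwards [self_mem_nhdsWithin] with δ hδ
      have : δ ≠ 0 := ne_of_gt hδ
      simpa using this
  have h2 := ((riemannZeta_residue_one.comp h1).norm).log (by simp)
  rw [norm_one, Real.log_one] at h2
  refine h2.congr' ?_
  filter_upwards [self_mem_nhdsWithin] with δ hδ
  have hδ' : (0 : ℝ) < δ := hδ
  have hs : 1 < (((1 + δ : ℝ) : ℂ)).re := by simpa using hδ'
  have h0 := norm_ne_zero_iff.mpr (riemannZeta_ne_zero_of_one_lt_re hs)
  have e : ((1 + δ : ℝ) : ℂ) - 1 = ((δ : ℝ) : ℂ) := by push_cast; ring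
  rw [tsum_zetaLogWeight hδ', Function.comp_apply, e, norm_mul, Complex.norm_real,
    Real.norm_of_nonneg hδ'.le, Real.log_mul hδ'.ne' h0]
  ring

lemma tendsto_tsum_eulerLogWeight_mul_rpow_add_log :
    Tendsto (fun δ : ℝ => ∑' n : ℕ, eulerLogWeight n * (n : ℝ) ^ (-δ) + Real.log δ)
      (𝓝[>] 0) (𝓝 0) := by
  have h1 : Tendsto (fun δ : ℝ => ∑' n : ℕ,
      (eulerLogWeight n * (n : ℝ) ^ (-δ) - zetaLogWeight δ n)) (𝓝[>] 0)
      (𝓝 (∑' _ : ℕ, (0 : ℝ))) := by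
    refine tendsto_tsum_of_dominated_convergence summable_two_div_sq (fun n => ?_) ?_
    · refine Tendsto.mono_left ?_ nhdsWithin_le_nhds
      unfold eulerLogWeight zetaLogWeight
      split_ifs with h
      · have h2 : (2 : ℝ) ≤ n := by exact_mod_cast h.two_le
        have hn0 : (n : ℝ) ≠ 0 := by linarith
        have h3 : 1 / (n : ℝ) ≤ 1 / 2 := one_div_le_one_div_of_le (by norm_num) h2
        have hc : ContinuousAt (fun δ : ℝ => -Real.log (1 - 1 / (n : ℝ)) * (n : ℝ) ^ (-δ) -
            -Real.log (1 - 1 / (n : ℝ) ^ (1 + δ))) 0 := by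
          have c1 : ContinuousAt (fun δ : ℝ => (n : ℝ) ^ (-δ)) 0 :=
            continuousAt_const.rpow (by fun_prop) (Or.inl hn0)
          have c2 : ContinuousAt (fun δ : ℝ => (n : ℝ) ^ (1 + δ)) 0 :=
            continuousAt_const.rpow (by fun_prop) (Or.inl hn0)
          refine (continuousAt_const.mul c1).sub
            ((continuousAt_const.sub (continuousAt_const.div c2 ?_)).log ?_).neg
          · simpa using hn0
          · have h4 : 0 < 1 - 1 / (n : ℝ) ^ (1 + (0 : ℝ)) := by
              rw [add_zero, Real.rpow_one]
              linarith
            exact h4.ne'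
        simpa [ContinuousAt] using hc
      · simp
    · filter_upwards [self_mem_nhdsWithin] with δ hδ n
      exact abs_eulerLogWeight_mul_sub_zetaLogWeight_le (le_of_lt hδ) n
  have h2 := h1.add tendsto_tsum_zetaLogWeight_add_log
  rw [tsum_zero, zero_add] at h2
  refine h2.congr' ?_
  filter_upwards [self_mem_nhdsWithin] with δ hδ
  rw [(summable_eulerLogWeight_mul_rpow hδ).tsum_sub (summable_zetaLogWeight hδ)]
  ring

/-- The total weight of the primes `p` with `⌈log p⌉ = n`. -/
noncomputable def eulerLogBlock (n : ℕ) : ℝ :=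
  ∑' k : ((fun k : ℕ => ⌈Real.log k⌉₊) ⁻¹' {n}), eulerLogWeight k

lemma sum_eulerLogBlock (N : ℕ) :
    ∑ n ∈ Finset.range (N + 1), eulerLogBlock n =
      ∑ k ∈ Finset.range (⌊Real.exp N⌋₊ + 1), eulerLogWeight k := by
  have hmem : ∀ k : ℕ, 0 < k → (⌈Real.log k⌉₊ < N + 1 ↔ k < ⌊Real.exp N⌋₊ + 1) := by
    intro k hk
    have hk' : (0 : ℝ) < k := by exact_mod_cast hk
    rw [Nat.lt_succ_iff, Nat.lt_succ_iff, Nat.ceil_le, Nat.le_floor_iff (Real.exp_pos _).le,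
      Real.log_le_iff_le_exp hk']
  have hb : ∀ n ∈ Finset.range (N + 1), eulerLogBlock n =
      ∑ k ∈ Finset.range (⌊Real.exp N⌋₊ + 1) with ⌈Real.log (k : ℕ)⌉₊ = n, eulerLogWeight k := by
    intro n hn
    rw [Finset.mem_range] at hn
    rw [eulerLogBlock, tsum_subtype, tsum_eq_sum (s := Finset.range (⌊Real.exp N⌋₊ + 1)),
      Finset.sum_filter]
    · refine Finset.sum_congr rfl fun k _ => ?_
      by_cases h : ⌈Real.log (k : ℕ)⌉₊ = n
      · rw [if_pos h]
        exact Set.indicator_of_mem (show k ∈ (fun k : ℕ => ⌈Real.log k⌉₊) ⁻¹' {n} from h) _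
      · rw [if_neg h]
        exact Set.indicator_of_notMem (show k ∉ (fun k : ℕ => ⌈Real.log k⌉₊) ⁻¹' {n} from h) _
    · intro k hk
      rw [Finset.mem_range] at hk
      refine Set.indicator_of_notMem (fun h => hk ?_) _
      have h' : ⌈Real.log k⌉₊ = n := h
      refine (hmem k (by omega)).mp (by omega)
  rw [Finset.sum_congr rfl hb]
  refine Finset.sum_fiberwise_of_maps_to (fun k hk => ?_) _
  rcases Nat.eq_zero_or_pos k with rfl | h
  · simp
  · exact Finset.mem_range.mpr ((hmem k h).mpr (Finset.mem_range.mp hk))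

lemma exp_neg_pow_ceil_log_bounds {δ : ℝ} (hδ : 0 < δ) {k : ℕ} (hk : 0 < k) :
    Real.exp (-δ) * (k : ℝ) ^ (-δ) ≤ Real.exp (-δ) ^ ⌈Real.log k⌉₊ ∧
      Real.exp (-δ) ^ ⌈Real.log k⌉₊ ≤ (k : ℝ) ^ (-δ) := by
  have hk' : (0 : ℝ) < k := by exact_mod_cast hk
  have h1 := Nat.le_ceil (Real.log k)
  have h2 := Nat.ceil_lt_add_one (Real.log_natCast_nonneg k)
  rw [Real.rpow_def_of_pos hk', ← Real.exp_nat_mul, ← Real.exp_add, Real.exp_le_exp,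
    Real.exp_le_exp]
  constructor <;> nlinarith

lemma eulerLogWeight_mul_exp_neg_pow_le {δ : ℝ} (hδ : 0 < δ) (k : ℕ) :
    eulerLogWeight k * Real.exp (-δ) ^ ⌈Real.log k⌉₊ ≤ eulerLogWeight k * (k : ℝ) ^ (-δ) := by
  rcases Nat.eq_zero_or_pos k with rfl | hk
  · simp [eulerLogWeight]
  · exact mul_le_mul_of_nonneg_left (exp_neg_pow_ceil_log_bounds hδ hk).2 (eulerLogWeight_nonneg k)

lemma le_eulerLogWeight_mul_exp_neg_pow {δ : ℝ} (hδ : 0 < δ) (k : ℕ) :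
    Real.exp (-δ) * (eulerLogWeight k * (k : ℝ) ^ (-δ)) ≤
      eulerLogWeight k * Real.exp (-δ) ^ ⌈Real.log k⌉₊ := by
  rcases Nat.eq_zero_or_pos k with rfl | hk
  · simp [eulerLogWeight]
  · rw [mul_left_comm]
    exact mul_le_mul_of_nonneg_left (exp_neg_pow_ceil_log_bounds hδ hk).1 (eulerLogWeight_nonneg k)

lemma summable_eulerLogWeight_mul_exp_neg_pow {δ : ℝ} (hδ : 0 < δ) :
    Summable fun k : ℕ => eulerLogWeight k * Real.exp (-δ) ^ ⌈Real.log k⌉₊ :=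
  Summable.of_nonneg_of_le (fun k => mul_nonneg (eulerLogWeight_nonneg k) (by positivity))
    (eulerLogWeight_mul_exp_neg_pow_le hδ) (summable_eulerLogWeight_mul_rpow hδ)

lemma hasSum_eulerLogBlock_mul_pow {δ : ℝ} (hδ : 0 < δ) :
    HasSum (fun n => eulerLogBlock n * Real.exp (-δ) ^ n)
      (∑' k : ℕ, eulerLogWeight k * Real.exp (-δ) ^ ⌈Real.log k⌉₊) := by
  have h := (summable_eulerLogWeight_mul_exp_neg_pow hδ).hasSum.tsum_fiberwise
    (fun k : ℕ => ⌈Real.log k⌉₊)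
  have e : ∀ n, ∑' k : ((fun k : ℕ => ⌈Real.log k⌉₊) ⁻¹' {n}),
      eulerLogWeight k * Real.exp (-δ) ^ ⌈Real.log (k : ℕ)⌉₊ =
        eulerLogBlock n * Real.exp (-δ) ^ n := by
    intro n
    rw [eulerLogBlock, ← tsum_mul_right]
    refine tsum_congr fun k => ?_
    have hk : ⌈Real.log (k : ℕ)⌉₊ = n := k.2
    rw [hk]
  simpa only [e] using h

lemma tendsto_tsum_eulerLogBlock_add_log :
    Tendsto (fun δ : ℝ => ∑' k : ℕ, eulerLogWeight k * Real.exp (-δ) ^ ⌈Real.log k⌉₊ +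
      Real.log (1 - Real.exp (-δ))) (𝓝[>] 0) (𝓝 0) := by
  set F : ℝ → ℝ := fun δ => ∑' n : ℕ, eulerLogWeight n * (n : ℝ) ^ (-δ)
  set S : ℝ → ℝ := fun δ => ∑' k : ℕ, eulerLogWeight k * Real.exp (-δ) ^ ⌈Real.log k⌉₊
  have hF : Tendsto (fun δ => F δ + Real.log δ) (𝓝[>] 0) (𝓝 0) :=
    tendsto_tsum_eulerLogWeight_mul_rpow_add_log
  have hid : Tendsto (fun δ : ℝ => δ) (𝓝[>] 0) (𝓝 0) := nhdsWithin_le_nhds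
  have hδF : Tendsto (fun δ => δ * F δ) (𝓝[>] 0) (𝓝 0) := by
    have h1 := (hid.mul hF).sub (tendsto_log_mul_rpow_nhdsGT_zero zero_lt_one)
    simp only [mul_zero, sub_zero, Real.rpow_one] at h1
    exact h1.congr fun δ => by ring
  have hdiff : Tendsto (fun δ => F δ - S δ) (𝓝[>] 0) (𝓝 0) := by
    refine tendsto_of_tendsto_of_tendsto_of_le_of_le' tendsto_const_nhds hδF ?_ ?_
    · filter_upwards [self_mem_nhdsWithin] with δ hδ
      exact sub_nonneg.mpr ((summable_eulerLogWeight_mul_exp_neg_pow hδ).tsum_le_tsum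
        (eulerLogWeight_mul_exp_neg_pow_le hδ) (summable_eulerLogWeight_mul_rpow hδ))
    · filter_upwards [self_mem_nhdsWithin] with δ hδ
      have h1 := ((summable_eulerLogWeight_mul_rpow hδ).mul_left (Real.exp (-δ))).tsum_le_tsum
        (le_eulerLogWeight_mul_exp_neg_pow hδ) (summable_eulerLogWeight_mul_exp_neg_pow hδ)
      rw [tsum_mul_left] at h1
      have h2 : 0 ≤ F δ :=
        tsum_nonneg fun k => mul_nonneg (eulerLogWeight_nonneg k) (by positivity)
      have h3 := mul_le_mul_of_nonneg_right (Real.add_one_le_exp (-δ)) h2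
      change _ * F δ ≤ S δ at h1
      linarith
  have hlog : Tendsto (fun δ : ℝ => Real.log ((1 - Real.exp (-δ)) / δ)) (𝓝[>] 0) (𝓝 0) := by
    have hd : HasDerivAt (fun δ : ℝ => 1 - Real.exp (-δ)) 1 0 := by
      simpa using ((hasDerivAt_neg (0 : ℝ)).exp).const_sub 1
    have h1 := (hasDerivAt_iff_tendsto_slope_zero.mp hd).mono_left
      (nhdsWithin_mono 0 fun δ (hδ : (0 : ℝ) < δ) => ne_of_gt hδ)
    have h2 := h1.log one_ne_zero
    rw [Real.log_one] at h2
    refine h2.congr fun δ => ?_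
    simp [div_eq_inv_mul]
  have h := (hF.sub hdiff).add hlog
  simp only [sub_zero, add_zero] at h
  refine h.congr' ?_
  filter_upwards [self_mem_nhdsWithin] with δ hδ
  have hδ' : (0 : ℝ) < δ := hδ
  have h1 : 0 < 1 - Real.exp (-δ) := by
    have := Real.exp_lt_one_iff.mpr (show -δ < 0 by linarith)
    linarith
  rw [Real.log_div h1.ne' hδ'.ne']
  ring

lemma sum_range_inv_eq_harmonic (N : ℕ) :
    ∑ n ∈ Finset.range (N + 1), (n : ℝ)⁻¹ = harmonic N := by
  rw [Finset.sum_range_succ']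
  simp [harmonic]

lemma tsum_sub_inv_mul_pow {δ : ℝ} (hδ : 0 < δ) :
    ∑' n : ℕ, (eulerLogBlock n - (n : ℝ)⁻¹) * Real.exp (-δ) ^ n =
      ∑' k : ℕ, eulerLogWeight k * Real.exp (-δ) ^ ⌈Real.log k⌉₊ +
        Real.log (1 - Real.exp (-δ)) := by
  have hx : |Real.exp (-δ)| < 1 := by
    rw [abs_of_pos (Real.exp_pos _)]
    exact Real.exp_lt_one_iff.mpr (by linarith)
  have h1 : HasSum (fun n : ℕ => (n : ℝ)⁻¹ * Real.exp (-δ) ^ n)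
      (-Real.log (1 - Real.exp (-δ))) := by
    rw [← hasSum_nat_add_iff' 1]
    simpa [div_eq_inv_mul] using Real.hasSum_pow_div_log_of_abs_lt_one hx
  have h2 := (hasSum_eulerLogBlock_mul_pow hδ).sub h1
  rw [sub_neg_eq_add] at h2
  rw [← h2.tsum_eq]
  exact tsum_congr fun n => by ring

lemma tendsto_log_log_floor_exp_sub_log :
    Tendsto (fun N : ℕ => Real.log (Real.log ((⌊Real.exp N⌋₊ + 1 : ℕ) : ℝ)) - Real.log N)
      atTop (𝓝 0) := by
  refine tendsto_of_tendsto_of_tendsto_of_le_of_le' tendsto_const_nhds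
    (tendsto_one_div_atTop_nhds_zero_nat (𝕜 := ℝ)) ?_ ?_
  all_goals
    filter_upwards [eventually_ge_atTop 1] with N hN
    have hN' : (1 : ℝ) ≤ N := by exact_mod_cast hN
    have hM1 : Real.exp N ≤ ((⌊Real.exp N⌋₊ + 1 : ℕ) : ℝ) := by
      push_cast
      exact (Nat.lt_floor_add_one _).le
    have h1 : (N : ℝ) ≤ Real.log ((⌊Real.exp N⌋₊ + 1 : ℕ) : ℝ) := by
      rw [Real.le_log_iff_exp_le ((Real.exp_pos _).trans_le hM1)]
      exact hM1
  · have := Real.log_le_log (by linarith) h1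
    linarith
  · have hM2 : ((⌊Real.exp N⌋₊ + 1 : ℕ) : ℝ) ≤ Real.exp (N + 1) := by
      have h2 := Nat.floor_le (Real.exp_pos N).le
      have h3 := Real.add_one_le_exp (N : ℝ)
      have h4 := Real.add_one_le_exp (1 : ℝ)
      have h5 := mul_le_mul_of_nonneg_left h4 (Real.exp_pos N).le
      rw [Real.exp_add]
      push_cast
      linarith
    have h2 : Real.log ((⌊Real.exp N⌋₊ + 1 : ℕ) : ℝ) ≤ N + 1 := by
      rw [Real.log_le_iff_le_exp ((Real.exp_pos _).trans_le hM1)]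
      exact hM2
    have h3 : Real.log (Real.log ((⌊Real.exp N⌋₊ + 1 : ℕ) : ℝ)) ≤ Real.log (N + 1) :=
      Real.log_le_log (by linarith) h2
    have h4 : Real.log ((N + 1) / N) ≤ (N + 1) / N - 1 :=
      Real.log_le_sub_one_of_pos (by positivity)
    rw [Real.log_div (by linarith) (by linarith)] at h4
    have h5 : ((N : ℝ) + 1) / N - 1 = 1 / N := by field_simp; ring
    linarith

/-- Mertens' second theorem for the weight `-log (1 - 1 / p)`, whose constant is `γ`. -/
lemma exists_abs_sum_eulerLogWeight_sub_log_log_sub_eulerMascheroni_le :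
    ∃ K : ℝ, 0 ≤ K ∧ ∀ n : ℕ, 2 ≤ n →
      |∑ k ∈ Finset.range n, eulerLogWeight k - Real.log (Real.log n) -
        Real.eulerMascheroniConstant| ≤ K / Real.log n := by
  obtain ⟨C, K, hK, h⟩ := exists_abs_sum_eulerLogWeight_sub_log_log_sub_le
  suffices hC : C = Real.eulerMascheroniConstant from hC ▸ ⟨K, hK, h⟩
  have hA : Tendsto (fun n : ℕ => ∑ k ∈ Finset.range n, eulerLogWeight k -
      Real.log (Real.log n)) atTop (𝓝 C) := by
    rw [tendsto_iff_norm_sub_tendsto_zero]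
    refine squeeze_zero' (Eventually.of_forall fun _ => norm_nonneg _) ?_
      ((Real.tendsto_log_atTop.comp tendsto_natCast_atTop_atTop).const_div_atTop K)
    filter_upwards [eventually_ge_atTop 2] with n hn
    exact h n hn
  have hfloor : Tendsto (fun N : ℕ => ⌊Real.exp N⌋₊ + 1) atTop atTop :=
    (tendsto_add_atTop_nat 1).comp (tendsto_nat_floor_atTop.comp
      (Real.tendsto_exp_atTop.comp tendsto_natCast_atTop_atTop))
  have hpartial : Tendsto (fun N => ∑ n ∈ Finset.range N, (eulerLogBlock n - (n : ℝ)⁻¹)) atTop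
      (𝓝 (C - Real.eulerMascheroniConstant)) := by
    rw [← tendsto_add_atTop_iff_nat 1]
    have h1 := ((hA.comp hfloor).add tendsto_log_log_floor_exp_sub_log).sub
      Real.tendsto_harmonic_sub_log
    rw [add_zero] at h1
    refine h1.congr fun N => ?_
    rw [Finset.sum_sub_distrib, sum_eulerLogBlock, sum_range_inv_eq_harmonic, Function.comp_apply]
    ring
  have hexp : Tendsto (fun δ : ℝ => Real.exp (-δ)) (𝓝[>] 0) (𝓝[<] 1) := by
    refine tendsto_nhdsWithin_of_tendsto_nhds_of_eventually_within _ ?_ ?_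
    · have : Continuous fun δ : ℝ => Real.exp (-δ) := by fun_prop
      simpa using (this.tendsto 0).mono_left nhdsWithin_le_nhds
    · filter_upwards [self_mem_nhdsWithin] with δ hδ
      exact Real.exp_lt_one_iff.mpr (neg_neg_of_pos hδ)
  have habel := (Real.tendsto_tsum_powerSeries_nhdsWithin_lt hpartial).comp hexp
  have hzero := tendsto_nhds_unique habel (tendsto_tsum_eulerLogBlock_add_log.congr' (by
    filter_upwards [self_mem_nhdsWithin] with δ hδ
    exact (tsum_sub_inv_mul_pow hδ).symm))
  linarith

/-- Mertens' third theorem. -/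
lemma exists_abs_prod_one_sub_inv_sub_le :
    ∃ c : ℝ, 0 ≤ c ∧ ∀ᶠ x : ℕ in atTop,
      Real.exp (-Real.eulerMascheroniConstant) / Real.log x * (1 + -c / Real.log x) ≤
          ∏ p ∈ (Finset.range x).filter Nat.Prime, (1 - 1 / (p : ℝ)) ∧
        ∏ p ∈ (Finset.range x).filter Nat.Prime, (1 - 1 / (p : ℝ)) ≤
          Real.exp (-Real.eulerMascheroniConstant) / Real.log x * (1 + c / Real.log x) := by
  obtain ⟨K, hK, h⟩ := exists_abs_sum_eulerLogWeight_sub_log_log_sub_eulerMascheroni_le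
  refine ⟨2 * K, by linarith, ?_⟩
  filter_upwards [eventually_ge_atTop 2, (Real.tendsto_log_atTop.comp
    tendsto_natCast_atTop_atTop).eventually_ge_atTop (K + 1)] with n hn hlog
  rw [Function.comp_apply] at hlog
  have hl : 0 < Real.log n := by linarith
  have hprod : ∏ p ∈ (Finset.range n).filter Nat.Prime, (1 - 1 / (p : ℝ)) =
      Real.exp (-∑ k ∈ Finset.range n, eulerLogWeight k) := by
    rw [← Finset.sum_neg_distrib, Real.exp_sum, Finset.prod_filter]
    refine Finset.prod_congr rfl fun k _ => ?_
    unfold eulerLogWeight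
    split_ifs with hk
    · have h2 : (1 : ℝ) < k := by exact_mod_cast hk.one_lt
      have h3 := (div_lt_one (by linarith)).mpr h2
      rw [neg_neg, Real.exp_log (by linarith)]
    · simp
  set E := ∑ k ∈ Finset.range n, eulerLogWeight k - Real.log (Real.log n) -
    Real.eulerMascheroniConstant with hE
  have hEn : |E| ≤ K / Real.log n := h n hn
  have hK1 : K / Real.log n ≤ 1 := (div_le_one hl).mpr (by linarith)
  have hexp := Real.abs_exp_sub_one_le (x := -E) (by rw [abs_neg]; linarith)
  rw [abs_neg, abs_le] at hexp
  have e : Real.exp (-∑ k ∈ Finset.range n, eulerLogWeight k) =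
      Real.exp (-Real.eulerMascheroniConstant) / Real.log n * Real.exp (-E) := by
    have e1 : -∑ k ∈ Finset.range n, eulerLogWeight k =
        -Real.eulerMascheroniConstant - Real.log (Real.log n) + -E := by
      rw [hE]
      ring
    rw [e1, Real.exp_add, Real.exp_sub, Real.exp_log hl]
  have e2 : 2 * K / Real.log n = 2 * (K / Real.log n) := by ring
  have e3 : -(2 * K) / Real.log n = -(2 * (K / Real.log n)) := by ring
  rw [hprod, e, e2, e3]
  constructor <;> refine mul_le_mul_of_nonneg_left ?_ (by positivity) <;> linarith

/-- The ratio of the Mertens bounds at two points whose logarithms differ by `2 * c + 2`. -/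
lemma div_mul_one_add_div_lt {c L : ℝ} (hc : 0 ≤ c) (hL : 10 * (c + 1) ^ 2 ≤ L) :
    1 / (L + (2 * c + 2)) * (1 + c / (L + (2 * c + 2))) <
      (1 - 1 / L) * (1 / L * (1 + -c / L)) := by
  have hL0 : 0 < L := by nlinarith
  have hM : 0 < L + (2 * c + 2) := by linarith
  have e1 : 1 / (L + (2 * c + 2)) * (1 + c / (L + (2 * c + 2))) =
      (L + 3 * c + 2) / (L + (2 * c + 2)) ^ 2 := by
    field_simp
    ring
  have e2 : (1 - 1 / L) * (1 / L * (1 + -c / L)) = (L - 1) * (L - c) / L ^ 3 := by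
    field_simp
    ring
  rw [e1, e2, div_lt_div_iff₀ (by positivity) (by positivity)]
  have h1 : 4 * (c + 1) ^ 3 < L ^ 2 := by
    have h2 : (10 * (c + 1) ^ 2) ^ 2 ≤ L ^ 2 := pow_le_pow_left₀ (by positivity) hL 2
    nlinarith [pow_pos (show 0 < c + 1 by linarith) 3,
      mul_nonneg hc (pow_pos (show 0 < c + 1 by linarith) 3).le]
  have h2 := mul_pos hL0 (sub_pos.mpr h1)
  have h3 : 0 ≤ c * L ^ 2 + 4 * (c + 1) * c * L + 4 * (c + 1) ^ 2 * c := by positivity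
  linarith

theorem density_of_good_numbers :
    ∃ c₁ c₂ : ℝ,
      (∀ᶠ (x : ℕ) in atTop,
        Real.exp (-Real.eulerMascheroniConstant) / Real.log x * (1 + c₁ / Real.log x) ≤
          ∏ p ∈ (Finset.range x).filter Nat.Prime, (1 - 1 / (p : ℝ)) ∧
        ∏ p ∈ (Finset.range x).filter Nat.Prime, (1 - 1 / (p : ℝ)) ≤
          Real.exp (-Real.eulerMascheroniConstant) / Real.log x * (1 + c₂ / Real.log x)) ∧
      (∀ᶠ (b₁ : ℕ) in atTop,
        1 / Real.log b₁ <
          1 - ∏ p ∈ (Finset.Icc b₁ ⌊Real.exp (c₂ - c₁ + 2) * b₁⌋₊).filter Nat.Prime,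
            (1 - 1 / (p : ℝ))) := by
  obtain ⟨c, hc, h⟩ := exists_abs_prod_one_sub_inv_sub_le
  refine ⟨-c, c, h, ?_⟩
  obtain ⟨N, hN⟩ := eventually_atTop.mp h
  filter_upwards [eventually_ge_atTop N, eventually_ge_atTop 2, (Real.tendsto_log_atTop.comp
    tendsto_natCast_atTop_atTop).eventually_ge_atTop (10 * (c + 1) ^ 2)] with b hbN hb2 hlog
  rw [Function.comp_apply] at hlog
  have hb0 : (0 : ℝ) < b := by positivity
  have hconst : c - -c + 2 = 2 * c + 2 := by ring
  rw [hconst]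
  set M := ⌊Real.exp (2 * c + 2) * b⌋₊ with hM
  have hbM : b ≤ M := by
    refine Nat.le_floor ?_
    have := Real.one_le_exp (show 0 ≤ 2 * c + 2 by linarith)
    nlinarith
  set L := Real.log b with hL
  have hL0 : 0 < L := Real.log_pos (by exact_mod_cast hb2)
  have hlogM : L + (2 * c + 2) ≤ Real.log ((M + 1 : ℕ) : ℝ) := by
    have h1 : Real.exp (2 * c + 2) * b ≤ ((M + 1 : ℕ) : ℝ) := by
      push_cast
      exact (Nat.lt_floor_add_one _).le
    have h2 := Real.log_le_log (by positivity) h1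
    rw [Real.log_mul (Real.exp_pos _).ne' hb0.ne', Real.log_exp] at h2
    linarith
  have hsplit : (∏ p ∈ (Finset.range b).filter Nat.Prime, (1 - 1 / (p : ℝ))) *
      ∏ p ∈ (Finset.Icc b M).filter Nat.Prime, (1 - 1 / (p : ℝ)) =
        ∏ p ∈ (Finset.range (M + 1)).filter Nat.Prime, (1 - 1 / (p : ℝ)) := by
    simp only [Finset.prod_filter]
    have hI : Finset.Icc b M = Finset.Ico b (M + 1) := by
      ext k
      simp
    rw [hI]
    exact Finset.prod_range_mul_prod_Ico _ (by omega)
  set γ := Real.exp (-Real.eulerMascheroniConstant)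
  have hγ : 0 < γ := Real.exp_pos _
  have hlow := (hN b hbN).1
  have hup := (hN (M + 1) (by omega)).2
  have hup' : γ / Real.log ((M + 1 : ℕ) : ℝ) * (1 + c / Real.log ((M + 1 : ℕ) : ℝ)) ≤
      γ * (1 / (L + (2 * c + 2)) * (1 + c / (L + (2 * c + 2)))) := by
    have hpos : 0 < L + (2 * c + 2) := by linarith
    rw [← mul_assoc, mul_one_div]
    gcongr
  have hkey := mul_lt_mul_of_pos_left (div_mul_one_add_div_lt hc hlog) hγ
  set P := ∏ p ∈ (Finset.range b).filter Nat.Prime, (1 - 1 / (p : ℝ))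
  have hP : 0 < P := Finset.prod_pos fun p hp => by
    have h2 : (1 : ℝ) < p := by exact_mod_cast (Finset.mem_filter.mp hp).2.one_lt
    have := (div_lt_one (by linarith)).mpr h2
    linarith
  have hone : 0 ≤ 1 - 1 / L := by
    have : 1 / L ≤ 1 := (div_le_one hL0).mpr (by nlinarith)
    linarith
  have hlow' := mul_le_mul_of_nonneg_left hlow hone
  set Q := ∏ p ∈ (Finset.Icc b M).filter Nat.Prime, (1 - 1 / (p : ℝ))
  have hfin : P * Q < P * (1 - 1 / L) := by
    rw [hsplit]
    calc _ ≤ _ := hup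
      _ ≤ _ := hup'
      _ < _ := hkey
      _ = (1 - 1 / L) * (γ / L * (1 + -c / L)) := by ring
      _ ≤ (1 - 1 / L) * P := hlow'
      _ = _ := by ring
  have := lt_of_mul_lt_mul_left hfin hP.le
  linarith
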